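/- There is a universal constant C > 0 such that for every real p ≥ 2, all integers d ≥ 1 and n ≥ 2, every n-point subset M of ℓ_p^d, and every Δ > 0, the metric space M admits a (C·p^4·√(min{log n, d}), Δ)-Lipschitz decomposition. -/

import Mathlib

noncomputable section

open scoped NNReal ENNReal

/-- A `(β, Δ)`-Lipschitz decomposition of a (pseudo)metric space `α`: a probability
distribution over partitions of `α` (encoded as equivalence relations / setoids) such that
every cluster of every partition in the support has diameter at most `Δ` (i.e. any two
equivalent points are at distance at most `Δ`), and any two points `x, y` are separated
(put in different clusters) with probability at most `β * dist x y / Δ`. -/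
def LipschitzDecomp (α : Type*) [PseudoMetricSpace α] (β Δ : ℝ) : Prop :=
  ∃ D : PMF (Setoid α),
    (∀ R ∈ D.support, ∀ x y : α, R.r x y → dist x y ≤ Δ) ∧
    (∀ x y : α, D.toOuterMeasure {R | ¬ R.r x y} ≤ ENNReal.ofReal (β * dist x y / Δ))

open Classical in
/-- The indicator of a proposition, as a real number. -/
def ind (A : Prop) : ℝ := if A then 1 else 0

lemma ind_true {A : Prop} (h : A) : ind A = 1 := if_pos h

lemma ind_false {A : Prop} (h : ¬ A) : ind A = 0 := if_neg h

lemma ind_nonneg (A : Prop) : 0 ≤ ind A := by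
  unfold ind; split_ifs <;> norm_num

lemma ind_le_one (A : Prop) : ind A ≤ 1 := by
  unfold ind; split_ifs <;> norm_num

lemma ind_not (A : Prop) : ind (¬ A) = 1 - ind A := by
  by_cases h : A <;> simp [ind, h]

/-- A random partition of `α` on a finite probability space. -/
structure RandPart (α : Type) where
  Ω : Type
  fin : Fintype Ω
  w : Ω → ℝ
  w_nonneg : ∀ ω, 0 ≤ w ω
  w_sum : ∑ ω, w ω = 1
  R : Ω → Setoid α

namespace RandPart

attribute [instance] RandPart.fin

variable {α : Type}

/-- The probability that two points lie in different clusters. -/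
def sep (P : RandPart α) (x y : α) : ℝ := ∑ ω, P.w ω * ind (¬ (P.R ω).r x y)

lemma sep_nonneg (P : RandPart α) (x y : α) : 0 ≤ P.sep x y :=
  Finset.sum_nonneg fun ω _ => mul_nonneg (P.w_nonneg ω) (ind_nonneg _)

lemma one_sub_sep (P : RandPart α) (x y : α) :
    1 - P.sep x y = ∑ ω, P.w ω * ind ((P.R ω).r x y) := by
  simp only [sep, ind_not, mul_sub, Finset.sum_sub_distrib, mul_one, P.w_sum]
  ring

/-- The deterministic partition. -/
def pure (R : Setoid α) : RandPart α where
  Ω := Unit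
  fin := inferInstance
  w _ := 1
  w_nonneg _ := zero_le_one
  w_sum := by simp
  R _ := R

lemma sep_pure (R : Setoid α) (x y : α) : (pure R).sep x y = ind (¬ R.r x y) := by
  change ∑ _ω : Unit, (1 : ℝ) * ind (¬ R.r x y) = _
  simp

/-- The image of a random partition under a map of partitions. -/
def map (P : RandPart α) (T : Setoid α → Setoid α) : RandPart α :=
  { P with R := fun ω => T (P.R ω) }

/-- The mixture of a finite family of random partitions. -/
def mix {Ω : Type} [Fintype Ω] (w : Ω → ℝ) (h0 : ∀ ω, 0 ≤ w ω) (h1 : ∑ ω, w ω = 1)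
    (Q : Ω → RandPart α) : RandPart α where
  Ω := Σ ω, (Q ω).Ω
  fin := inferInstance
  w s := w s.1 * (Q s.1).w s.2
  w_nonneg s := mul_nonneg (h0 _) ((Q _).w_nonneg _)
  w_sum := by
    rw [Fintype.sum_sigma]
    simp [← Finset.mul_sum, (Q _).w_sum, h1]
  R s := (Q s.1).R s.2

lemma sep_mix {Ω : Type} [Fintype Ω] (w : Ω → ℝ) (h0 : ∀ ω, 0 ≤ w ω) (h1 : ∑ ω, w ω = 1)
    (Q : Ω → RandPart α) (x y : α) :
    (mix w h0 h1 Q).sep x y = ∑ ω, w ω * (Q ω).sep x y := by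
  simp only [sep, Finset.mul_sum]
  unfold mix
  rw [Fintype.sum_sigma]
  simp [mul_assoc]

end RandPart

/-- A `(β, Δ)`-Lipschitz decomposition of a finite space with distance function `ρ`, on a finite
probability space. -/
def FinDecomp {α : Type} (ρ : α → α → ℝ) (β Δ : ℝ) : Prop :=
  ∃ P : RandPart α, (∀ ω x y, (P.R ω).r x y → ρ x y ≤ Δ) ∧
    ∀ x y, P.sep x y ≤ β * ρ x y / Δ

lemma FinDecomp.mono {α : Type} {ρ : α → α → ℝ} (hρ : ∀ x y, 0 ≤ ρ x y) {β β' Δ : ℝ}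
    (hΔ : 0 < Δ) (h : FinDecomp ρ β Δ) (hβ : β ≤ β') : FinDecomp ρ β' Δ := by
  obtain ⟨P, h1, h2⟩ := h
  refine ⟨P, h1, fun x y => (h2 x y).trans ?_⟩
  have := hρ x y
  gcongr

lemma FinDecomp.lipschitzDecomp {α : Type} [PseudoMetricSpace α] {β Δ : ℝ}
    (h : FinDecomp (fun x y : α => dist x y) β Δ) : LipschitzDecomp α β Δ := by
  obtain ⟨P, h1, h2⟩ := h
  have hs : ∑ ω, ENNReal.ofReal (P.w ω) = 1 := by
    rw [← ENNReal.ofReal_sum_of_nonneg fun ω _ => P.w_nonneg ω, P.w_sum, ENNReal.ofReal_one]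
  refine ⟨(PMF.ofFintype (fun ω => ENNReal.ofReal (P.w ω)) hs).map P.R, ?_, ?_⟩
  · intro R hR x y hxy
    obtain ⟨ω, -, rfl⟩ := (PMF.mem_support_map_iff _ _ _).1 hR
    exact h1 ω x y hxy
  · intro x y
    rw [PMF.toOuterMeasure_map_apply, PMF.toOuterMeasure_apply, tsum_fintype]
    refine le_trans (le_of_eq ?_) (ENNReal.ofReal_le_ofReal (h2 x y))
    rw [RandPart.sep, ENNReal.ofReal_sum_of_nonneg fun ω _ =>
      mul_nonneg (P.w_nonneg ω) (ind_nonneg _)]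
    refine Finset.sum_congr rfl fun ω _ => ?_
    by_cases h : (P.R ω).r x y <;> simp [ind, h, Set.indicator]

/-- The cut of single linkage at height `Δ / n`. -/
lemma exists_single_linkage {α : Type} [Fintype α] {ρ : α → α → ℝ} (h0 : ∀ x, ρ x x = 0)
    (hs : ∀ x y, ρ x y = ρ y x) (ht : ∀ x y z, ρ x z ≤ ρ x y + ρ y z) {Δ : ℝ} (hΔ : 0 < Δ) :
    ∃ R : Setoid α, (∀ x y, R.r x y → ρ x y ≤ Δ) ∧
      ∀ x y, ind (¬ R.r x y) ≤ Fintype.card α * ρ x y / Δ := by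
  classical
  have hρ : ∀ x y, 0 ≤ ρ x y := fun x y => by linarith [ht x y x, h0 x, hs x y]
  let G : SimpleGraph α :=
    { Adj := fun x y => x ≠ y ∧ ρ x y ≤ Δ / Fintype.card α
      symm := ⟨fun x y h => ⟨h.1.symm, hs x y ▸ h.2⟩⟩
      loopless := ⟨fun x h => h.1 rfl⟩ }
  have hw : ∀ x y (W : G.Walk x y), ρ x y ≤ W.length * (Δ / Fintype.card α) := by
    intro x y W
    induction W with
    | nil => simp [h0]
    | cons h p ih =>
      rw [SimpleGraph.Walk.length_cons]
      push_cast
      have := h.2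
      linarith [ht _ _ _ |>.trans (add_le_add h.2 ih)]
  refine ⟨G.reachableSetoid, fun x y h => ?_, fun x y => ?_⟩
  · obtain ⟨W, hW⟩ := SimpleGraph.Reachable.exists_isPath h
    have hl : (W.length : ℝ) ≤ Fintype.card α := by exact_mod_cast hW.length_lt.le
    have hc : (0 : ℝ) < Fintype.card α := by exact_mod_cast Fintype.card_pos_iff.2 ⟨x⟩
    calc ρ x y ≤ W.length * (Δ / Fintype.card α) := hw x y W
      _ ≤ Fintype.card α * (Δ / Fintype.card α) := by gcongr
      _ = Δ := by field_simp
  · have hc : (0 : ℝ) < Fintype.card α := by exact_mod_cast Fintype.card_pos_iff.2 ⟨x⟩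
    have hp := hρ x y
    by_cases h : G.reachableSetoid.r x y
    · rw [ind_false (not_not.2 h)]; positivity
    · rw [ind_true h]
      have hxy : x ≠ y := fun e => h (e ▸ G.reachableSetoid.refl x)
      have : ¬ ρ x y ≤ Δ / Fintype.card α := fun e =>
        h (SimpleGraph.Adj.reachable (G := G) ⟨hxy, e⟩)
      rw [not_le, div_lt_iff₀ hc] at this
      rw [le_div_iff₀ hΔ]
      linarith

/-- A random partition whose clusters are rarely too large yields a decomposition. -/
lemma RandPart.finDecomp {α : Type} [Fintype α] {ρ : α → α → ℝ} (h0 : ∀ x, ρ x x = 0)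
    (hs : ∀ x y, ρ x y = ρ y x) (ht : ∀ x y z, ρ x z ≤ ρ x y + ρ y z) {β Δ : ℝ} (hΔ : 0 < Δ)
    (P : RandPart α) (hsep : ∀ x y, P.sep x y ≤ β * ρ x y / Δ)
    (hlarge : ∀ x y, Δ < ρ x y → 1 - P.sep x y ≤ 1 / (Fintype.card α : ℝ) ^ 3) :
    FinDecomp ρ (β + 1) Δ := by
  classical
  obtain ⟨R₀, hR, hR'⟩ := exists_single_linkage h0 hs ht hΔ
  set n : ℝ := (Fintype.card α : ℝ)
  have hρ : ∀ x y, 0 ≤ ρ x y := fun x y => by linarith [ht x y x, h0 x, hs x y]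
  let good : Setoid α → Prop := fun R => ∀ x y, R.r x y → ρ x y ≤ Δ
  refine ⟨P.map fun R => if good R then R else R₀, fun ω x y h => ?_, fun x y => ?_⟩
  · change (if good (P.R ω) then P.R ω else R₀).r x y at h
    by_cases hg : good (P.R ω)
    · rw [if_pos hg] at h; exact hg x y h
    · rw [if_neg hg] at h; exact hR x y h
  · have hn : 0 < n := by simp only [n]; exact_mod_cast Fintype.card_pos_iff.2 ⟨x⟩
    have hbad : ∀ R : Setoid α, ind (¬ good R) ≤
        ∑ q : α × α, ind (Δ < ρ q.1 q.2) * ind (R.r q.1 q.2) := by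
      intro R
      have hnn : ∀ q : α × α, 0 ≤ ind (Δ < ρ q.1 q.2) * ind (R.r q.1 q.2) := fun q =>
        mul_nonneg (ind_nonneg _) (ind_nonneg _)
      by_cases hg : good R
      · rw [ind_false (not_not.2 hg)]; exact Finset.sum_nonneg fun q _ => hnn q
      · rw [ind_true hg]
        simp only [good] at hg
        push Not at hg
        obtain ⟨a, b, hr, hl⟩ := hg
        refine le_trans ?_ (Finset.single_le_sum (fun q _ => hnn q) (Finset.mem_univ (a, b)))
        rw [ind_true hl, ind_true hr, one_mul]
    have hpb : ∑ ω, P.w ω * ind (¬ good (P.R ω)) ≤ n ^ 2 * (1 / n ^ 3) := by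
      calc ∑ ω, P.w ω * ind (¬ good (P.R ω))
          ≤ ∑ ω, P.w ω * ∑ q : α × α, ind (Δ < ρ q.1 q.2) * ind ((P.R ω).r q.1 q.2) :=
            Finset.sum_le_sum fun ω _ => mul_le_mul_of_nonneg_left (hbad _) (P.w_nonneg ω)
        _ = ∑ q : α × α, ind (Δ < ρ q.1 q.2) * (1 - P.sep q.1 q.2) := by
            simp only [RandPart.one_sub_sep, Finset.mul_sum]
            rw [Finset.sum_comm]
            exact Finset.sum_congr rfl fun q _ => Finset.sum_congr rfl fun ω _ => by ring
        _ ≤ ∑ q : α × α, 1 / n ^ 3 := by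
            refine Finset.sum_le_sum fun q _ => ?_
            by_cases h : Δ < ρ q.1 q.2
            · rw [ind_true h, one_mul]; exact hlarge _ _ h
            · rw [ind_false h, zero_mul]; positivity
        _ = n ^ 2 * (1 / n ^ 3) := by
            rw [Finset.sum_const, Finset.card_univ, Fintype.card_prod, nsmul_eq_mul, pow_two]
            push_cast
            rfl
    have hstep : ∀ ω, ind (¬ (if good (P.R ω) then P.R ω else R₀).r x y) ≤
        ind (¬ (P.R ω).r x y) + ind (¬ good (P.R ω)) * ind (¬ R₀.r x y) := by
      intro ω
      by_cases hg : good (P.R ω)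
      · rw [if_pos hg, ind_false (not_not.2 hg)]; simp
      · rw [if_neg hg, ind_true hg]; linarith [ind_nonneg (¬ (P.R ω).r x y)]
    calc (P.map fun R => if good R then R else R₀).sep x y
        ≤ ∑ ω, P.w ω * (ind (¬ (P.R ω).r x y) + ind (¬ good (P.R ω)) * ind (¬ R₀.r x y)) :=
          Finset.sum_le_sum fun ω _ => mul_le_mul_of_nonneg_left (hstep ω) (P.w_nonneg ω)
      _ = P.sep x y + (∑ ω, P.w ω * ind (¬ good (P.R ω))) * ind (¬ R₀.r x y) := by
          simp only [mul_add, Finset.sum_add_distrib, RandPart.sep, Finset.sum_mul, mul_assoc]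
      _ ≤ β * ρ x y / Δ + n ^ 2 * (1 / n ^ 3) * (n * ρ x y / Δ) := by
          gcongr
          · exact hsep x y
          · exact ind_nonneg _
          · exact hR' x y
      _ = (β + 1) * ρ x y / Δ := by field_simp

/-- The partition whose first cluster is `S`, and which agrees with `R` off `S`. -/
def carve {α : Type} (S : Set α) (R : Setoid α) : Setoid α where
  r x y := (x ∈ S ∧ y ∈ S) ∨ (x ∉ S ∧ y ∉ S ∧ R.r x y)
  iseqv :=
    { refl := fun x => by
        by_cases h : x ∈ S
        · exact Or.inl ⟨h, h⟩
        · exact Or.inr ⟨h, h, R.refl x⟩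
      symm := by
        rintro x y (⟨h, h'⟩ | ⟨h, h', hr⟩)
        · exact Or.inl ⟨h', h⟩
        · exact Or.inr ⟨h', h, R.symm hr⟩
      trans := by
        rintro x y z (⟨h, h'⟩ | ⟨h, h', hr⟩) (⟨k, k'⟩ | ⟨k, k', kr⟩)
        · exact Or.inl ⟨h, k'⟩
        · exact absurd h' k
        · exact absurd k h'
        · exact Or.inr ⟨h, k', R.trans hr kr⟩ }

/-- Iterated carving by independent random sets. -/
def carveIter {α Ω : Type} [Fintype Ω] (w : Ω → ℝ) (h0 : ∀ ω, 0 ≤ w ω) (h1 : ∑ ω, w ω = 1)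
    (S : Ω → Set α) : ℕ → RandPart α
  | 0 => RandPart.pure ⊤
  | k + 1 => RandPart.mix w h0 h1 fun ω => (carveIter w h0 h1 S k).map (carve (S ω))

lemma RandPart.sep_map_carve {α : Type} (P : RandPart α) (S : Set α) (x y : α) :
    (P.map (carve S)).sep x y =
      ind (¬ (x ∈ S ↔ y ∈ S)) + ind (x ∉ S ∧ y ∉ S) * P.sep x y := by
  have hw := P.w_sum
  change ∑ ω, P.w ω * ind (¬ ((x ∈ S ∧ y ∈ S) ∨ (x ∉ S ∧ y ∉ S ∧ (P.R ω).r x y))) = _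
  simp only [RandPart.sep]
  by_cases hx : x ∈ S <;> by_cases hy : y ∈ S <;>
    simp [hx, hy, hw, ind_false not_false, ind_true trivial]

/-- Carving a finite space by random sets of small diameter. -/
lemma finDecomp_of_carving {α Ω : Type} [Fintype α] [Fintype Ω] {ρ : α → α → ℝ}
    (h0 : ∀ x, ρ x x = 0) (hs : ∀ x y, ρ x y = ρ y x) (ht : ∀ x y z, ρ x z ≤ ρ x y + ρ y z)
    {β Δ : ℝ} (hβ : 0 ≤ β) (hΔ : 0 < Δ) (w : Ω → ℝ) (hw : ∀ ω, 0 ≤ w ω) (S : Ω → Set α)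
    (hpos : ∀ x, 0 < ∑ ω, w ω * ind (x ∈ S ω))
    (hsep : ∀ x y, ∑ ω, w ω * ind (¬ (x ∈ S ω ↔ y ∈ S ω)) ≤
      (β * ρ x y / Δ) * ∑ ω, w ω * ind (x ∈ S ω))
    (hdiam : ∀ ω x y, w ω ≠ 0 → x ∈ S ω → y ∈ S ω → ρ x y ≤ Δ) :
    FinDecomp ρ (β + 1) Δ := by
  classical
  rcases isEmpty_or_nonempty α with hα | ⟨⟨x₀⟩⟩
  · exact ⟨RandPart.pure ⊤, fun ω x => hα.elim x, fun x => hα.elim x⟩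
  have hρ : ∀ x y, 0 ≤ ρ x y := fun x y => by linarith [ht x y x, h0 x, hs x y]
  set W := ∑ ω, w ω with hW
  have hWpos : 0 < W := (hpos x₀).trans_le <| Finset.sum_le_sum fun ω _ =>
    mul_le_of_le_one_right (hw ω) (ind_le_one _)
  let v : Ω → ℝ := fun ω => w ω / W
  have hv0 : ∀ ω, 0 ≤ v ω := fun ω => div_nonneg (hw ω) hWpos.le
  have hv1 : ∑ ω, v ω = 1 := by
    simp only [v, ← Finset.sum_div]; exact div_self hWpos.ne'
  let p : α → ℝ := fun x => ∑ ω, v ω * ind (x ∈ S ω)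
  have hp : ∀ x, p x = (∑ ω, w ω * ind (x ∈ S ω)) / W := fun x => by
    simp only [p, v, Finset.sum_div]
    exact Finset.sum_congr rfl fun ω _ => by ring
  have hppos : ∀ x, 0 < p x := fun x => by rw [hp]; exact div_pos (hpos x) hWpos
  have hp1 : ∀ x, ∑ ω, v ω * ind (x ∉ S ω) = 1 - p x := fun x => by
    simp only [ind_not, mul_sub, mul_one, Finset.sum_sub_distrib, hv1, p]
  let P := carveIter v hv0 hv1 S
  have hrec : ∀ k x y, (P (k + 1)).sep x y = ∑ ω, v ω * ind (¬ (x ∈ S ω ↔ y ∈ S ω)) +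
      (∑ ω, v ω * ind (x ∉ S ω ∧ y ∉ S ω)) * (P k).sep x y := by
    intro k x y
    simp only [P, carveIter, RandPart.sep_mix, RandPart.sep_map_carve, mul_add,
      Finset.sum_add_distrib, Finset.sum_mul, mul_assoc]
  have hneither : ∀ x y, ∑ ω, v ω * ind (x ∉ S ω ∧ y ∉ S ω) ≤ 1 - p x := by
    intro x y
    rw [← hp1]
    refine Finset.sum_le_sum fun ω _ => mul_le_mul_of_nonneg_left ?_ (hv0 ω)
    by_cases hx : x ∈ S ω
    · simp [ind, hx]
    · rw [ind_true hx]; exact ind_le_one _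
  have hsep' : ∀ x y, ∑ ω, v ω * ind (¬ (x ∈ S ω ↔ y ∈ S ω)) ≤ (β * ρ x y / Δ) * p x := by
    intro x y
    rw [hp, ← mul_div_assoc]
    have : ∑ ω, v ω * ind (¬ (x ∈ S ω ↔ y ∈ S ω)) =
        (∑ ω, w ω * ind (¬ (x ∈ S ω ↔ y ∈ S ω))) / W := by
      simp only [v, Finset.sum_div]
      exact Finset.sum_congr rfl fun ω _ => by ring
    rw [this]
    gcongr
    exact hsep x y
  have hA : ∀ k x y, (P k).sep x y ≤ β * ρ x y / Δ := by
    intro k x y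
    have hb : 0 ≤ β * ρ x y / Δ := by have := hρ x y; positivity
    induction k with
    | zero =>
      simp only [P, carveIter, RandPart.sep_pure]
      exact (ind_false (not_not.2 trivial)).trans_le hb
    | succ k ih =>
      rw [hrec]
      calc _ ≤ (β * ρ x y / Δ) * p x + (1 - p x) * (β * ρ x y / Δ) := by
            refine add_le_add (hsep' x y) ?_
            refine mul_le_mul (hneither x y) ih (RandPart.sep_nonneg _ _ _) ?_
            exact (Finset.sum_nonneg fun ω _ => mul_nonneg (hv0 ω) (ind_nonneg _)).trans
              (hneither x y)
        _ = β * ρ x y / Δ := by ring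
  have hB : ∀ k x y, Δ < ρ x y → 1 - (P k).sep x y ≤ (1 - p x) ^ k := by
    intro k x y hxy
    induction k with
    | zero => linarith [(P 0).sep_nonneg x y]
    | succ k ih =>
      have hsum : ∑ ω, v ω * ind (¬ (x ∈ S ω ↔ y ∈ S ω)) +
          ∑ ω, v ω * ind (x ∉ S ω ∧ y ∉ S ω) = 1 := by
        rw [← Finset.sum_add_distrib, ← hv1]
        refine Finset.sum_congr rfl fun ω _ => ?_
        by_cases hv : v ω = 0
        · simp [hv]
        have hwω : w ω ≠ 0 := fun e => hv (by simp [v, e])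
        by_cases hx : x ∈ S ω <;> by_cases hy : y ∈ S ω
        · exact absurd (hdiam ω x y hwω hx hy) (not_le.2 hxy)
        all_goals simp [ind, hx, hy]
      have hq : 0 ≤ ∑ ω, v ω * ind (x ∉ S ω ∧ y ∉ S ω) :=
        Finset.sum_nonneg fun ω _ => mul_nonneg (hv0 ω) (ind_nonneg _)
      have h1 : 0 ≤ 1 - (P k).sep x y := by
        rw [RandPart.one_sub_sep]
        exact Finset.sum_nonneg fun ω _ => mul_nonneg (RandPart.w_nonneg _ _) (ind_nonneg _)
      rw [hrec]
      calc _ = (∑ ω, v ω * ind (x ∉ S ω ∧ y ∉ S ω)) * (1 - (P k).sep x y) := by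
            linear_combination -hsum
        _ ≤ (1 - p x) * (1 - p x) ^ k :=
            mul_le_mul (hneither x y) ih h1 (hq.trans (hneither x y))
        _ = (1 - p x) ^ (k + 1) := by ring
  have hn : (0 : ℝ) < 1 / (Fintype.card α : ℝ) ^ 3 := by
    have : (0 : ℝ) < Fintype.card α := by exact_mod_cast Fintype.card_pos_iff.2 ⟨x₀⟩
    positivity
  have hk : ∃ k, ∀ x, (1 - p x) ^ k < 1 / (Fintype.card α : ℝ) ^ 3 := by
    have : ∀ x, ∀ᶠ k in Filter.atTop, (1 - p x) ^ k < 1 / (Fintype.card α : ℝ) ^ 3 := by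
      intro x
      refine (tendsto_pow_atTop_nhds_zero_of_lt_one ?_ ?_).eventually_lt_const hn
      · rw [← hp1]; exact Finset.sum_nonneg fun ω _ => mul_nonneg (hv0 ω) (ind_nonneg _)
      · linarith [hppos x]
    exact (Filter.eventually_all.2 this).exists
  obtain ⟨k, hk⟩ := hk
  exact (P k).finDecomp h0 hs ht hΔ (hA k) fun x y h => (hB k x y h).trans (hk x).le

section Carving

open MeasureTheory

lemma sum_measureReal_mul_ind {X : Type*} [MeasurableSpace X] {α : Type} [Fintype α]
    (μ : Measure X) [IsFiniteMeasure μ] (A : α → Set X) (hA : ∀ a, MeasurableSet (A a))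
    [Fintype (Set α)] (C : Set α → Prop) :
    ∑ T : Set α, μ.real {ω | {a | ω ∈ A a} = T} * ind (C T) =
      μ.real {ω | C {a | ω ∈ A a}} := by
  classical
  have hm : ∀ T : Set α, MeasurableSet {ω | {a | ω ∈ A a} = T} := by
    intro T
    have : {ω | {a | ω ∈ A a} = T} = ⋂ a, {ω | ω ∈ A a ↔ a ∈ T} := by
      ext ω
      simp [Set.ext_iff]
    rw [this]
    refine MeasurableSet.iInter fun a => ?_
    by_cases h : a ∈ T
    · simpa [h] using hA a
    · simp only [h, iff_false]
      exact (hA a).compl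
  have hU : {ω | C {a | ω ∈ A a}} =
      ⋃ T ∈ Finset.univ.filter C, {ω | {a | ω ∈ A a} = T} := by
    ext ω
    simp
  rw [hU, measureReal_biUnion_finset _ fun T _ => hm T, Finset.sum_filter]
  · exact Finset.sum_congr rfl fun T _ => by by_cases h : C T <;> simp [ind, h]
  · intro T _ T' _ hTT'
    refine Set.disjoint_left.2 fun ω h h' => hTT' (h.symm.trans h')

/-- Carving by a random set described by a finite measure. -/
lemma finDecomp_of_measure {X : Type*} [MeasurableSpace X] {α : Type} [Fintype α]
    {ρ : α → α → ℝ} (h0 : ∀ x, ρ x x = 0) (hs : ∀ x y, ρ x y = ρ y x)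
    (ht : ∀ x y z, ρ x z ≤ ρ x y + ρ y z) {β Δ : ℝ} (hβ : 0 ≤ β) (hΔ : 0 < Δ)
    (μ : Measure X) [IsFiniteMeasure μ] (A : α → Set X) (hA : ∀ a, MeasurableSet (A a)) {I : ℝ}
    (hI : 0 < I) (hAI : ∀ a, μ.real (A a) = I)
    (hinter : ∀ a b, 2 * (I - μ.real (A a ∩ A b)) ≤ (β * ρ a b / Δ) * I)
    (hdiam : ∀ a b ω, ω ∈ A a → ω ∈ A b → ρ a b ≤ Δ) : FinDecomp ρ (β + 1) Δ := by
  classical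
  let w : Set α → ℝ := fun T => μ.real {ω | {a | ω ∈ A a} = T}
  have hmem : ∀ x, ∑ T : Set α, w T * ind (x ∈ T) = I := fun x => by
    rw [sum_measureReal_mul_ind μ A hA fun T => x ∈ T]
    exact hAI x
  refine finDecomp_of_carving h0 hs ht hβ hΔ w (fun _ => measureReal_nonneg) id ?_ ?_ ?_
  · intro x
    exact hI.trans_eq (hmem x).symm
  · intro x y
    refine le_trans (le_of_eq ?_) ((hinter x y).trans_eq (congrArg _ (hmem x).symm))
    have hxy : ∑ T : Set α, w T * ind (x ∈ T ∧ y ∈ T) = μ.real (A x ∩ A y) :=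
      sum_measureReal_mul_ind μ A hA fun T => x ∈ T ∧ y ∈ T
    have hsum : ∑ T : Set α, w T * ind (¬ (x ∈ T ↔ y ∈ T)) =
        ∑ T : Set α, (w T * ind (x ∈ T) + w T * ind (y ∈ T) - 2 * (w T * ind (x ∈ T ∧ y ∈ T))) := by
      refine Finset.sum_congr rfl fun T _ => ?_
      by_cases hx : x ∈ T <;> by_cases hy : y ∈ T <;> simp [ind, hx, hy]
      ring
    refine hsum.trans ?_
    rw [Finset.sum_sub_distrib, Finset.sum_add_distrib, ← Finset.mul_sum, hmem, hmem, hxy]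
    ring
  · intro T x y hT hx hy
    have hne : {ω | {a | ω ∈ A a} = T}.Nonempty := by
      by_contra h
      rw [Set.not_nonempty_iff_eq_empty] at h
      exact hT (by simp only [w, h, measureReal_empty])
    obtain ⟨ω, hω⟩ := hne
    have hω' : {a | ω ∈ A a} = T := hω
    rw [id, ← hω'] at hx hy
    exact hdiam x y ω hx hy

section Gaussian

open Real

section Trunc

variable {E : Type*} [NormedAddCommGroup E]

/-- The truncated Gaussian supported on the ball of radius `r`. -/
def truncGaussian (b r : ℝ) (v : E) : ℝ := max (exp (-b * ‖v‖ ^ 2) - exp (-b * r ^ 2)) 0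

lemma norm_lt_of_truncGaussian_pos {b r : ℝ} (hb : 0 < b) (hr : 0 ≤ r) {v : E}
    (h : 0 < truncGaussian b r v) : ‖v‖ < r := by
  by_contra! hle
  refine h.not_ge (max_le ?_ le_rfl)
  rw [sub_nonpos, exp_le_exp]
  have : r ^ 2 ≤ ‖v‖ ^ 2 := by gcongr
  nlinarith

lemma continuous_truncGaussian (b r : ℝ) : Continuous (truncGaussian b r : E → ℝ) := by
  unfold truncGaussian; fun_prop

lemma abs_truncGaussian_sub_le (b r : ℝ) (u v : E) :
    |truncGaussian b r u - truncGaussian b r v| ≤ |exp (-b * ‖u‖ ^ 2) - exp (-b * ‖v‖ ^ 2)| := by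
  refine (abs_max_sub_max_le_abs _ _ _).trans_eq ?_
  congr 1; ring

end Trunc

variable {V : Type*} [NormedAddCommGroup V] [InnerProductSpace ℝ V] [FiniteDimensional ℝ V]
  [MeasurableSpace V] [BorelSpace V]

lemma integral_gaussian_norm_pos {b : ℝ} (hb : 0 < b) : 0 < ∫ v : V, exp (-b * ‖v‖ ^ 2) := by
  rw [GaussianFourier.integral_rexp_neg_mul_sq_norm hb]; positivity

lemma integrable_gaussian_norm {b : ℝ} (hb : 0 < b) :
    Integrable fun v : V => exp (-b * ‖v‖ ^ 2) :=
  .of_integral_ne_zero (integral_gaussian_norm_pos hb).ne'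

lemma integrable_gaussian_norm_sub {b : ℝ} (hb : 0 < b) (x : V) :
    Integrable fun v : V => exp (-b * ‖x - v‖ ^ 2) :=
  (integrable_gaussian_norm hb).comp_sub_left x

lemma integral_gaussian_norm_sub (b : ℝ) (x : V) :
    ∫ v : V, exp (-b * ‖x - v‖ ^ 2) = ∫ v : V, exp (-b * ‖v‖ ^ 2) :=
  integral_sub_left_eq_self (fun v : V => exp (-b * ‖v‖ ^ 2)) volume x

/-- The `L¹` distance between two translates of a Gaussian is Lipschitz in the translation. -/
lemma integral_abs_gaussian_sub_le {b : ℝ} (hb : 0 < b) (x y : V) :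
    ∫ v : V, |exp (-b * ‖x - v‖ ^ 2) - exp (-b * ‖y - v‖ ^ 2)| ≤
      √(2 * b) * ‖x - y‖ * ∫ v : V, exp (-b * ‖v‖ ^ 2) := by
  rcases eq_or_ne x y with rfl | hxy
  · simp
  set Z := ∫ v : V, exp (-b * ‖v‖ ^ 2) with hZ
  have hδ : 0 < ‖x - y‖ := norm_pos_iff.2 (sub_ne_zero.2 hxy)
  set δ := ‖x - y‖
  set s := √(2 * b) with hs
  have hs0 : 0 < s := by positivity
  have hs2 : s ^ 2 = 2 * b := sq_sqrt (by positivity)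
  have hZ0 : 0 < Z := integral_gaussian_norm_pos hb
  have hmid : ∀ v : V, exp (-b / 2 * ‖x - v‖ ^ 2) * exp (-b / 2 * ‖y - v‖ ^ 2) =
      exp (-(b * δ ^ 2 / 4)) * exp (-b * ‖(2⁻¹ : ℝ) • (x + y) - v‖ ^ 2) := by
    intro v
    rw [← exp_add, ← exp_add]
    congr 1
    have hp := parallelogram_law_with_norm ℝ (x - v) (y - v)
    have e1 : (x - v) - (y - v) = x - y := by abel
    have e2 : (x - v) + (y - v) = (2 : ℝ) • ((2⁻¹ : ℝ) • (x + y) - v) := by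
      module
    rw [e1, e2, norm_smul, norm_two] at hp
    change _ + δ ^ 2 = _ at hp
    linear_combination (b / 4) * hp
  have hpt : ∀ v : V, |exp (-b * ‖x - v‖ ^ 2) - exp (-b * ‖y - v‖ ^ 2)| ≤
      (2 / (s * δ)) * (exp (-b * ‖x - v‖ ^ 2) + exp (-b * ‖y - v‖ ^ 2) -
        2 * (exp (-(b * δ ^ 2 / 4)) * exp (-b * ‖(2⁻¹ : ℝ) • (x + y) - v‖ ^ 2))) +
      (s * δ / 4) * (exp (-b * ‖x - v‖ ^ 2) + exp (-b * ‖y - v‖ ^ 2)) := by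
    intro v
    rw [← hmid]
    have e : ∀ z : V, exp (-b * ‖z - v‖ ^ 2) = exp (-b / 2 * ‖z - v‖ ^ 2) ^ 2 := fun z => by
      rw [← exp_nat_mul]; congr 1; push_cast; ring
    rw [e x, e y]
    set p := exp (-b / 2 * ‖x - v‖ ^ 2)
    set q := exp (-b / 2 * ‖y - v‖ ^ 2)
    set u := s * δ
    have hu : 0 < u := by positivity
    have hp : 0 < p := exp_pos _
    have hq : 0 < q := exp_pos _
    have key : ∀ a c : ℝ, a * c ≤ 2 / u * a ^ 2 + u / 8 * c ^ 2 := by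
      intro a c
      have : 2 / u * a ^ 2 + u / 8 * c ^ 2 - a * c = (4 * a - u * c) ^ 2 / (8 * u) := by
        field_simp; ring
      have h2 : 0 ≤ (4 * a - u * c) ^ 2 / (8 * u) := by positivity
      linarith
    have h1 : u / 8 * (p + q) ^ 2 ≤ u / 4 * (p ^ 2 + q ^ 2) := by
      nlinarith [mul_nonneg hu.le (sq_nonneg (p - q))]
    rw [abs_le]
    constructor
    · linarith [key (q - p) (p + q)]
    · linarith [key (p - q) (p + q)]
  have ix := integrable_gaussian_norm_sub hb x
  have iy := integrable_gaussian_norm_sub hb y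
  have im := integrable_gaussian_norm_sub hb ((2⁻¹ : ℝ) • (x + y))
  have im' := (im.const_mul (exp (-(b * δ ^ 2 / 4)))).const_mul 2
  have ixy : Integrable fun v : V => exp (-b * ‖x - v‖ ^ 2) + exp (-b * ‖y - v‖ ^ 2) := ix.add iy
  have ixym : Integrable fun v : V => exp (-b * ‖x - v‖ ^ 2) + exp (-b * ‖y - v‖ ^ 2) -
      2 * (exp (-(b * δ ^ 2 / 4)) * exp (-b * ‖(2⁻¹ : ℝ) • (x + y) - v‖ ^ 2)) := ixy.sub im'
  refine (integral_mono (ix.sub iy).abs ((ixym.const_mul _).add (ixy.const_mul _)) hpt).trans ?_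
  · rw [integral_add' (ixym.const_mul _) (ixy.const_mul _), integral_const_mul, integral_const_mul,
      integral_sub ixy im', integral_add ix iy, integral_const_mul, integral_const_mul]
    simp only [integral_gaussian_norm_sub, ← hZ]
    have hexp : 1 - b * δ ^ 2 / 4 ≤ exp (-(b * δ ^ 2 / 4)) := one_sub_le_exp_neg _
    have : (2 / (s * δ)) * (Z + Z - 2 * (exp (-(b * δ ^ 2 / 4)) * Z)) ≤
        (2 / (s * δ)) * (b * δ ^ 2 / 2 * Z) := by
      gcongr
      nlinarith
    have e : (2 / (s * δ)) * (b * δ ^ 2 / 2 * Z) = s * δ * Z / 2 := by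
      field_simp
      linarith
    linarith

lemma integrable_truncGaussian {b : ℝ} (hb : 0 < b) (r : ℝ) :
    Integrable (truncGaussian b r : V → ℝ) := by
  refine (integrable_gaussian_norm hb).mono' (continuous_truncGaussian b r).aestronglyMeasurable ?_
  refine Filter.Eventually.of_forall fun v => ?_
  rw [norm_of_nonneg (show 0 ≤ truncGaussian b r v from le_max_right _ _)]
  exact max_le (by linarith [exp_pos (-b * r ^ 2)]) (exp_pos _).le

lemma integral_truncGaussian_ge {b r : ℝ} (hb : 0 < b) (hV : 1 ≤ Module.finrank ℝ V)
    (hbr : b * r ^ 2 = 4 * Module.finrank ℝ V) :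
    (∫ v : V, exp (-b * ‖v‖ ^ 2)) / 2 ≤ ∫ v : V, truncGaussian b r v := by
  have hpt : ∀ v : V, exp (-b * ‖v‖ ^ 2) - exp (-(b * r ^ 2 / 2)) * exp (-(b / 2) * ‖v‖ ^ 2) ≤
      truncGaussian b r v := by
    intro v
    have e1 : exp (-b * ‖v‖ ^ 2) = exp (-(b / 2) * ‖v‖ ^ 2) ^ 2 := by
      rw [← exp_nat_mul]; congr 1; push_cast; ring
    have e2 : exp (-b * r ^ 2) = exp (-(b * r ^ 2 / 2)) ^ 2 := by
      rw [← exp_nat_mul]; congr 1; push_cast; ring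
    rw [truncGaussian, e1, e2]
    have hp := exp_pos (-(b / 2) * ‖v‖ ^ 2)
    have hq := exp_pos (-(b * r ^ 2 / 2))
    rcases le_total (exp (-(b / 2) * ‖v‖ ^ 2)) (exp (-(b * r ^ 2 / 2))) with h | h
    · refine le_trans ?_ (le_max_right _ _)
      nlinarith
    · refine le_trans ?_ (le_max_left _ _)
      nlinarith
  have i1 := integrable_gaussian_norm (V := V) hb
  have i2 := integrable_gaussian_norm (V := V) (half_pos hb)
  refine le_trans ?_ (integral_mono (i1.sub (i2.const_mul _)) (integrable_truncGaussian hb r) hpt)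
  rw [integral_sub' i1 (i2.const_mul _), integral_const_mul]
  have hZ0 := integral_gaussian_norm_pos (V := V) hb
  set m := Module.finrank ℝ V
  have hZ : ∫ v : V, exp (-(b / 2) * ‖v‖ ^ 2) = 2 ^ (m / 2 : ℝ) * ∫ v : V, exp (-b * ‖v‖ ^ 2) := by
    rw [GaussianFourier.integral_rexp_neg_mul_sq_norm hb,
      GaussianFourier.integral_rexp_neg_mul_sq_norm (half_pos hb),
      ← mul_rpow (by positivity) (by positivity)]
    congr 1
    field_simp
  rw [hZ, hbr]
  have hm : (1 : ℝ) ≤ m := by exact_mod_cast hV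
  have h2 : (2 : ℝ) ^ (m / 2 : ℝ) ≤ exp m := by
    have : (2 : ℝ) ≤ exp 1 := by linarith [add_one_le_exp (1 : ℝ)]
    calc (2 : ℝ) ^ (m / 2 : ℝ) ≤ exp 1 ^ (m / 2 : ℝ) := by gcongr
      _ = exp (m / 2) := by rw [← exp_mul, one_mul]
      _ ≤ exp m := by gcongr; linarith
  have h3 : exp (-(4 * m / 2 : ℝ)) * 2 ^ (m / 2 : ℝ) ≤ 1 / 2 := by
    calc exp (-(4 * m / 2 : ℝ)) * 2 ^ (m / 2 : ℝ) ≤ exp (-(4 * m / 2 : ℝ)) * exp m := by gcongr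
      _ = exp (-m) := by rw [← exp_add]; congr 1; ring
      _ ≤ exp (-1) := by gcongr
      _ ≤ 1 / 2 := by
        rw [exp_neg, inv_eq_one_div]
        gcongr
        linarith [add_one_le_exp (1 : ℝ)]
  nlinarith

/-- Finite subsets of an `m`-dimensional Euclidean space have `O(√m)`-Lipschitz decompositions. -/
lemma finDecomp_of_finrank (hV : 1 ≤ Module.finrank ℝ V) {α : Type} [Fintype α] (f : α → V)
    {Δ : ℝ} (hΔ : 0 < Δ) :
    FinDecomp (fun x y => ‖f x - f y‖) (12 * √(Module.finrank ℝ V) + 1) Δ := by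
  set m := Module.finrank ℝ V
  have hm : (1 : ℝ) ≤ m := by exact_mod_cast hV
  let b : ℝ := 16 * m / Δ ^ 2
  have hb : 0 < b := by positivity
  have hbr : b * (Δ / 2) ^ 2 = 4 * m := by simp only [b]; field_simp; norm_num
  let F : V → ℝ := truncGaussian b (Δ / 2)
  let A : α → Set (V × ℝ) := fun a => regionBetween 0 (fun v => F (f a - v)) Set.univ
  have hF0 : ∀ v, 0 ≤ F v := fun v => le_max_right _ _
  have hFc : Continuous F := continuous_truncGaussian _ _
  have hA : ∀ a, MeasurableSet (A a) := fun a =>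
    measurableSet_regionBetween measurable_const (by fun_prop) MeasurableSet.univ
  have hFi : ∀ a, Integrable fun v => F (f a - v) := fun a =>
    (integrable_truncGaussian hb (Δ / 2)).comp_sub_left (f a)
  set I := ∫ v, F v with hI
  have hFI : ∀ a, ∫ v, F (f a - v) = I := fun a => integral_sub_left_eq_self F volume (f a)
  have hvol : ∀ h : V → ℝ, Integrable h → (∀ v, 0 ≤ h v) →
      (volume : Measure (V × ℝ)) (regionBetween 0 h Set.univ) = ENNReal.ofReal (∫ v, h v) := by
    intro h hi h0
    rw [Measure.volume_eq_prod, volume_regionBetween_eq_integral (integrable_zero _ _ _).integrableOn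
      hi.integrableOn MeasurableSet.univ fun v _ => h0 v]
    simp
  have hAfin : volume (⋃ a, A a) ≠ ∞ := by
    refine ne_of_lt ((measure_iUnion_fintype_le _ _).trans_lt (ENNReal.sum_lt_top.2 fun a _ => ?_))
    rw [hvol _ (hFi a) fun v => hF0 _]
    exact ENNReal.ofReal_lt_top
  have : IsFiniteMeasure (volume.restrict (⋃ a, A a)) := isFiniteMeasure_restrict.2 hAfin
  have hres : ∀ a (B : Set (V × ℝ)), B ⊆ A a →
      (volume.restrict (⋃ a, A a)).real B = volume.real B := by
    intro a B hB
    rw [measureReal_restrict_apply' (MeasurableSet.iUnion hA), Set.inter_eq_left.2]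
    exact hB.trans (Set.subset_iUnion A a)
  set Z := ∫ v : V, exp (-b * ‖v‖ ^ 2) with hZ
  have hZ0 : 0 < Z := integral_gaussian_norm_pos hb
  have hIZ : Z / 2 ≤ I := integral_truncGaussian_ge hb hV hbr
  refine finDecomp_of_measure (fun x => by simp) (fun x y => norm_sub_rev (f x) (f y))
    (fun x y z => norm_sub_le_norm_sub_add_norm_sub (f x) (f y) (f z)) (by positivity) hΔ
    (volume.restrict (⋃ a, A a)) A hA (I := I) (by linarith) ?_ ?_ ?_
  · intro a
    rw [hres a _ subset_rfl, measureReal_def, hvol _ (hFi a) fun v => hF0 _, hFI,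
      ENNReal.toReal_ofReal (by linarith)]
  · intro x y
    rw [hres x _ Set.inter_subset_left]
    have hmini : Integrable fun v => min (F (f x - v)) (F (f y - v)) := (hFi x).inf (hFi y)
    have hmin0 : ∀ v, 0 ≤ min (F (f x - v)) (F (f y - v)) := fun v => le_min (hF0 _) (hF0 _)
    have hxy : A x ∩ A y =
        regionBetween 0 (fun v => min (F (f x - v)) (F (f y - v))) Set.univ := by
      ext ⟨v, h⟩
      simp [A, regionBetween]
      tauto
    rw [hxy, measureReal_def, hvol _ hmini hmin0, ENNReal.toReal_ofReal (integral_nonneg hmin0)]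
    have h1 : 2 * (I - ∫ v, min (F (f x - v)) (F (f y - v))) =
        ∫ v, |F (f x - v) - F (f y - v)| := by
      have : ∀ v, |F (f x - v) - F (f y - v)| =
          F (f x - v) + F (f y - v) - 2 * min (F (f x - v)) (F (f y - v)) := by
        intro v
        rcases le_total (F (f x - v)) (F (f y - v)) with h | h
        · rw [min_eq_left h, abs_of_nonpos (by linarith)]; ring
        · rw [min_eq_right h, abs_of_nonneg (by linarith)]; ring
      simp only [this]
      have hxy' : Integrable fun v => F (f x - v) + F (f y - v) := (hFi x).add (hFi y)
      rw [integral_sub hxy' (hmini.const_mul _), integral_add (hFi x) (hFi y),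
        integral_const_mul, hFI, hFI]
      ring
    rw [h1]
    have h2 : ∫ v, |F (f x - v) - F (f y - v)| ≤ √(2 * b) * ‖f x - f y‖ * Z := by
      refine le_trans (integral_mono ((hFi x).sub (hFi y)).abs ?_ fun v =>
        abs_truncGaussian_sub_le b (Δ / 2) _ _) (integral_abs_gaussian_sub_le hb (f x) (f y))
      exact ((integrable_gaussian_norm_sub hb (f x)).sub (integrable_gaussian_norm_sub hb (f y))).abs
    have h3 : √(2 * b) ≤ 6 * √m / Δ := by
      rw [sqrt_le_left (by positivity), div_pow, mul_pow, sq_sqrt (by positivity)]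
      simp only [b]
      rw [← mul_div_assoc]
      refine div_le_div_of_nonneg_right ?_ (by positivity)
      linarith
    calc _ ≤ √(2 * b) * ‖f x - f y‖ * Z := h2
      _ ≤ (6 * √m / Δ) * ‖f x - f y‖ * (2 * I) := by gcongr; linarith
      _ = 12 * √m * ‖f x - f y‖ / Δ * I := by ring
  · rintro x y ⟨v, h⟩ ⟨-, hx⟩ ⟨-, hy⟩
    have hx' := norm_lt_of_truncGaussian_pos hb (by positivity) (hx.1.trans hx.2)
    have hy' := norm_lt_of_truncGaussian_pos hb (by positivity) (hy.1.trans hy.2)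
    have := norm_sub_le_norm_sub_add_norm_sub (f x) v (f y)
    rw [norm_sub_rev v] at this
    linarith

end Gaussian

end Carving

/-- The Rademacher sum with signs `ε` and coefficients `v`. -/
def radSum {d : ℕ} (ε : Fin d → Bool) (v : Fin d → ℝ) : ℝ :=
  ∑ j, (if ε j then 1 else -1) * v j

lemma radSum_sub {d : ℕ} (ε : Fin d → Bool) (u v : Fin d → ℝ) :
    radSum ε (u - v) = radSum ε u - radSum ε v := by
  simp [radSum, mul_sub]

lemma sum_radSum_succ {d : ℕ} (g : ℝ → ℝ) (v : Fin (d + 1) → ℝ) :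
    ∑ ε, g (radSum ε v) = ∑ ε : Fin d → Bool,
      (g (v 0 + radSum ε (Fin.tail v)) + g (-v 0 + radSum ε (Fin.tail v))) := by
  rw [← (Fin.consEquiv fun _ : Fin (d + 1) => Bool).sum_comp, Fintype.sum_prod_type_right]
  refine Finset.sum_congr rfl fun ε _ => ?_
  simp [radSum, Fin.sum_univ_succ, Fin.consEquiv, Fin.tail]

lemma sum_radSum_sq {d : ℕ} (v : Fin d → ℝ) :
    ∑ ε, radSum ε v ^ 2 = 2 ^ d * ∑ j, v j ^ 2 := by
  induction d with
  | zero => simp [radSum]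
  | succ d ih =>
    rw [sum_radSum_succ (fun t => t ^ 2), Fin.sum_univ_succ]
    set s := ∑ i : Fin d, v i.succ ^ 2
    have h2 : ∑ ε, radSum ε (Fin.tail v) ^ 2 = 2 ^ d * s := ih (Fin.tail v)
    calc _ = ∑ ε : Fin d → Bool, (2 * v 0 ^ 2 + 2 * radSum ε (Fin.tail v) ^ 2) :=
          Finset.sum_congr rfl fun ε _ => by ring
      _ = _ := by
          simp only [Finset.sum_add_distrib, ← Finset.mul_sum, h2]
          simp
          ring

lemma sum_radSum_pow_four_le {d : ℕ} (v : Fin d → ℝ) :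
    ∑ ε, radSum ε v ^ 4 ≤ 3 * 2 ^ d * (∑ j, v j ^ 2) ^ 2 := by
  induction d with
  | zero => simp [radSum]
  | succ d ih =>
    rw [sum_radSum_succ (fun t => t ^ 4), Fin.sum_univ_succ]
    set s := ∑ i : Fin d, v i.succ ^ 2
    have h4 : ∑ ε, radSum ε (Fin.tail v) ^ 4 ≤ 3 * 2 ^ d * s ^ 2 := ih (Fin.tail v)
    have h2 : ∑ ε, radSum ε (Fin.tail v) ^ 2 = 2 ^ d * s := sum_radSum_sq (Fin.tail v)
    calc _ = ∑ ε : Fin d → Bool, (2 * v 0 ^ 4 + 12 * v 0 ^ 2 * radSum ε (Fin.tail v) ^ 2 +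
            2 * radSum ε (Fin.tail v) ^ 4) :=
          Finset.sum_congr rfl fun ε _ => by ring
      _ = 2 ^ d * (2 * v 0 ^ 4) + 12 * v 0 ^ 2 * (2 ^ d * s) +
            2 * ∑ ε : Fin d → Bool, radSum ε (Fin.tail v) ^ 4 := by
          simp only [Finset.sum_add_distrib, ← Finset.mul_sum, h2]
          simp
          ring
      _ ≤ 2 ^ d * (2 * v 0 ^ 4) + 12 * v 0 ^ 2 * (2 ^ d * s) + 2 * (3 * 2 ^ d * s ^ 2) := by
          gcongr
      _ ≤ 3 * 2 ^ (d + 1) * (v 0 ^ 2 + s) ^ 2 := by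
          have h : (0 : ℝ) ≤ 4 * (2 ^ d * v 0 ^ 4) := by positivity
          have : 3 * 2 ^ (d + 1) * (v 0 ^ 2 + s) ^ 2 - (2 ^ d * (2 * v 0 ^ 4) +
            12 * v 0 ^ 2 * (2 ^ d * s) + 2 * (3 * 2 ^ d * s ^ 2)) = 4 * (2 ^ d * v 0 ^ 4) := by
            ring
          linarith

lemma exp_neg_le_quadratic {t : ℝ} (ht : 0 ≤ t) : Real.exp (-t) ≤ 1 - t + t ^ 2 / 2 := by
  have h := Real.quadratic_le_exp_of_nonneg ht
  have hp := Real.exp_pos (-t)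
  have he : Real.exp t * Real.exp (-t) = 1 := by rw [← Real.exp_add]; simp
  have hq : 0 ≤ 1 - t + t ^ 2 / 2 := by nlinarith [sq_nonneg (t - 1)]
  have h1 : 1 ≤ Real.exp t * (1 - t + t ^ 2 / 2) := by
    nlinarith [mul_le_mul_of_nonneg_right h hq, sq_nonneg (t ^ 2)]
  nlinarith [mul_le_mul_of_nonneg_right h1 hp.le]

lemma sum_exp_neg_radSum_le {d : ℕ} (v : Fin d → ℝ) {s : ℝ} (hs : s = ∑ j, v j ^ 2)
    (hs0 : 0 < s) :
    ∑ ε, Real.exp (-(radSum ε v ^ 2 / (3 * s))) ≤ 2 ^ d * Real.exp (-(1 / 6)) := by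
  calc _ ≤ ∑ ε, (1 - radSum ε v ^ 2 / (3 * s) + (radSum ε v ^ 2 / (3 * s)) ^ 2 / 2) :=
        Finset.sum_le_sum fun ε _ => exp_neg_le_quadratic (by positivity)
    _ = 2 ^ d - (∑ ε, radSum ε v ^ 2) / (3 * s) + (∑ ε, radSum ε v ^ 4) / (18 * s ^ 2) := by
        rw [Finset.sum_add_distrib, Finset.sum_sub_distrib, Finset.sum_div, Finset.sum_div]
        simp only [Finset.sum_const, Finset.card_univ, Fintype.card_pi, Fintype.card_bool,
          Finset.prod_const, Fintype.card_fin, nsmul_eq_mul, mul_one, Nat.cast_pow, Nat.cast_ofNat]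
        congr 1
        refine Finset.sum_congr rfl fun ε _ => ?_
        field_simp
        ring
    _ ≤ 2 ^ d - (2 ^ d * s) / (3 * s) + (3 * 2 ^ d * s ^ 2) / (18 * s ^ 2) := by
        rw [sum_radSum_sq, ← hs]
        gcongr
        rw [hs]
        exact sum_radSum_pow_four_le v
    _ = 2 ^ d * (1 - 1 / 6) := by field_simp; ring
    _ ≤ 2 ^ d * Real.exp (-(1 / 6)) := by
        gcongr
        exact Real.one_sub_le_exp_neg _

/-- The random projection of a vector by a matrix of signs. -/
def signProj {d k : ℕ} (ω : Fin k → Fin d → Bool) (v : EuclideanSpace ℝ (Fin d)) :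
    EuclideanSpace ℝ (Fin k) :=
  WithLp.toLp 2 fun i => radSum (ω i) v.ofLp

lemma signProj_sub {d k : ℕ} (ω : Fin k → Fin d → Bool) (u v : EuclideanSpace ℝ (Fin d)) :
    signProj ω (u - v) = signProj ω u - signProj ω v := by
  ext i
  simp [signProj, radSum_sub]

lemma norm_signProj_sq {d k : ℕ} (ω : Fin k → Fin d → Bool) (v : EuclideanSpace ℝ (Fin d)) :
    ‖signProj ω v‖ ^ 2 = ∑ i, radSum (ω i) v.ofLp ^ 2 := by
  rw [EuclideanSpace.norm_sq_eq]
  simp [signProj]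

lemma sum_norm_signProj_sq {d k : ℕ} (v : EuclideanSpace ℝ (Fin d)) :
    ∑ ω : Fin k → Fin d → Bool, ‖signProj ω v‖ ^ 2 = (2 ^ d) ^ k * (k * ‖v‖ ^ 2) := by
  rcases Nat.eq_zero_or_pos k with rfl | hk
  · simp [norm_signProj_sq]
  simp only [norm_signProj_sq]
  rw [Finset.sum_comm]
  have h : ∀ i : Fin k, ∑ ω : Fin k → Fin d → Bool, radSum (ω i) v.ofLp ^ 2 =
      (2 ^ d) ^ k * ‖v‖ ^ 2 := by
    intro i
    have := Fintype.sum_piFinset_apply (fun ε : Fin d → Bool => radSum ε v.ofLp ^ 2) Finset.univ i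
    rw [Fintype.piFinset_univ] at this
    rw [this, sum_radSum_sq, EuclideanSpace.norm_sq_eq]
    simp
    obtain ⟨m, rfl⟩ := Nat.exists_eq_succ_of_ne_zero hk.ne'
    simp [pow_succ]
    ring
  simp only [h, Finset.sum_const, Finset.card_univ, Fintype.card_fin, nsmul_eq_mul]
  ring

lemma sum_norm_signProj_le {d k : ℕ} (hk : 0 < k) (v : EuclideanSpace ℝ (Fin d)) :
    ∑ ω : Fin k → Fin d → Bool, 1 / ((2 : ℝ) ^ d) ^ k * ‖signProj ω v‖ ≤ √k * ‖v‖ := by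
  rcases eq_or_ne v 0 with rfl | hv
  · have : ∀ ω : Fin k → Fin d → Bool, signProj ω (0 : EuclideanSpace ℝ (Fin d)) = 0 := fun ω => by
      simpa using signProj_sub ω 0 0
    simp [this]
  have hk' : (0 : ℝ) < k := by exact_mod_cast hk
  set a := √k * ‖v‖ with ha
  have ha0 : 0 < a := mul_pos (Real.sqrt_pos.2 hk') (norm_pos_iff.2 hv)
  have ha2 : a ^ 2 = k * ‖v‖ ^ 2 := by rw [ha, mul_pow, Real.sq_sqrt hk'.le]
  have hpt : ∀ t : ℝ, t ≤ t ^ 2 / (2 * a) + a / 2 := by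
    intro t
    have : t ^ 2 / (2 * a) + a / 2 - t = (t - a) ^ 2 / (2 * a) := by field_simp; ring
    have h2 : 0 ≤ (t - a) ^ 2 / (2 * a) := by positivity
    linarith
  calc _ ≤ ∑ ω : Fin k → Fin d → Bool,
        1 / ((2 : ℝ) ^ d) ^ k * (‖signProj ω v‖ ^ 2 / (2 * a) + a / 2) := by
        gcongr
        exact hpt _
    _ = 1 / ((2 : ℝ) ^ d) ^ k *
          ((∑ ω : Fin k → Fin d → Bool, ‖signProj ω v‖ ^ 2) / (2 * a) +
            ((2 : ℝ) ^ d) ^ k * (a / 2)) := by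
        rw [← Finset.mul_sum, Finset.sum_add_distrib, Finset.sum_div]
        simp
    _ = a := by
        rw [sum_norm_signProj_sq, ← ha2]
        field_simp
        ring

lemma sum_ind_norm_signProj_le {d k : ℕ} {v : EuclideanSpace ℝ (Fin d)} (hv : v ≠ 0) :
    ∑ ω : Fin k → Fin d → Bool,
      1 / ((2 : ℝ) ^ d) ^ k * ind (‖signProj ω v‖ ^ 2 ≤ k * ‖v‖ ^ 2 / 4) ≤
        Real.exp (-(k / 12)) := by
  have hs0 : 0 < ‖v‖ ^ 2 := by have := norm_pos_iff.2 hv; positivity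
  set s := ‖v‖ ^ 2 with hs
  have hs' : s = ∑ j, v.ofLp j ^ 2 := by
    rw [hs, EuclideanSpace.norm_sq_eq]; simp
  have hpt : ∀ ω : Fin k → Fin d → Bool, ind (‖signProj ω v‖ ^ 2 ≤ k * s / 4) ≤
      Real.exp (k / 12) * ∏ i, Real.exp (-(radSum (ω i) v.ofLp ^ 2 / (3 * s))) := by
    intro ω
    rw [← Real.exp_sum, ← Real.exp_add]
    by_cases h : ‖signProj ω v‖ ^ 2 ≤ k * s / 4
    · rw [ind_true h]
      refine Real.one_le_exp ?_
      rw [Finset.sum_neg_distrib, ← Finset.sum_div, ← norm_signProj_sq]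
      have : ‖signProj ω v‖ ^ 2 / (3 * s) ≤ (k * s / 4) / (3 * s) := by gcongr
      have e : (k * s / 4) / (3 * s) = (k : ℝ) / 12 := by field_simp; ring
      linarith
    · rw [ind_false h]; positivity
  calc _ ≤ ∑ ω : Fin k → Fin d → Bool, 1 / ((2 : ℝ) ^ d) ^ k *
        (Real.exp (k / 12) * ∏ i, Real.exp (-(radSum (ω i) v.ofLp ^ 2 / (3 * s)))) := by
        gcongr
        exact hpt _
    _ = 1 / ((2 : ℝ) ^ d) ^ k * (Real.exp (k / 12) *
          (∑ ε, Real.exp (-(radSum ε v.ofLp ^ 2 / (3 * s)))) ^ k) := by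
        rw [← Finset.mul_sum, ← Finset.mul_sum, Fintype.sum_pow]
    _ ≤ 1 / ((2 : ℝ) ^ d) ^ k * (Real.exp (k / 12) * (2 ^ d * Real.exp (-(1 / 6))) ^ k) := by
        gcongr
        exact sum_exp_neg_radSum_le _ hs' hs0
    _ = Real.exp (-(k / 12)) := by
        rw [mul_pow, ← Real.exp_nat_mul]
        have : Real.exp (-((k : ℝ) / 12)) = Real.exp (k / 12) * Real.exp (k * -(1 / 6)) := by
          rw [← Real.exp_add]; congr 1; ring
        rw [this]
        field_simp

/-- Dimension reduction for Lipschitz decompositions of Euclidean point sets. -/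
lemma finDecomp_of_signProj {d k : ℕ} (hk : 0 < k) {α : Type} [Fintype α]
    (hcard : Real.exp (-(k / 12)) ≤ 1 / (Fintype.card α : ℝ) ^ 3)
    (f : α → EuclideanSpace ℝ (Fin d)) {Δ : ℝ} (hΔ : 0 < Δ) :
    FinDecomp (fun x y => ‖f x - f y‖) (24 * √k + 3) Δ := by
  have hk' : (1 : ℝ) ≤ k := by exact_mod_cast hk
  have hsk : 0 < √(k : ℝ) := Real.sqrt_pos.2 (by linarith)
  have hsk1 : 1 ≤ √(k : ℝ) := Real.one_le_sqrt.2 hk'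
  have hD : ∀ ω : Fin k → Fin d → Bool,
      FinDecomp (fun x y => ‖signProj ω (f x) - signProj ω (f y)‖) (12 * √k + 1) (√k * Δ / 2) := by
    intro ω
    have := finDecomp_of_finrank (V := EuclideanSpace ℝ (Fin k))
      (by rw [finrank_euclideanSpace_fin]; exact hk) (fun x => signProj ω (f x)) (Δ := √k * Δ / 2) (by positivity)
    simpa using this
  choose D hD1 hD2 using hD
  let w : (Fin k → Fin d → Bool) → ℝ := fun _ => 1 / ((2 : ℝ) ^ d) ^ k
  have hw0 : ∀ ω, 0 ≤ w ω := fun ω => by positivity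
  have hw1 : ∑ ω, w ω = 1 := by simp [w]
  have := RandPart.finDecomp (ρ := fun x y => ‖f x - f y‖) (fun x => by simp)
    (fun x y => norm_sub_rev (f x) (f y))
    (fun x y z => norm_sub_le_norm_sub_add_norm_sub (f x) (f y) (f z)) (β := 24 * √k + 2) hΔ
    (RandPart.mix w hw0 hw1 D) ?_ ?_
  · convert this using 1; ring
  · intro x y
    rw [RandPart.sep_mix]
    calc _ ≤ ∑ ω, w ω * ((12 * √k + 1) * ‖signProj ω (f x - f y)‖ / (√k * Δ / 2)) := by
          refine Finset.sum_le_sum fun ω _ => mul_le_mul_of_nonneg_left ?_ (hw0 ω)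
          rw [signProj_sub]
          exact hD2 ω x y
      _ = (12 * √k + 1) / (√k * Δ / 2) * ∑ ω, w ω * ‖signProj ω (f x - f y)‖ := by
          rw [Finset.mul_sum]
          exact Finset.sum_congr rfl fun ω _ => by ring
      _ ≤ (12 * √k + 1) / (√k * Δ / 2) * (√k * ‖f x - f y‖) := by
          gcongr
          exact sum_norm_signProj_le hk _
      _ = (24 * √k + 2) * ‖f x - f y‖ / Δ := by field_simp; ring
  · intro x y hxy
    refine le_trans ?_ ((sum_ind_norm_signProj_le (k := k) (v := f x - f y) ?_).trans hcard)
    · rw [RandPart.sep_mix]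
      nth_rewrite 1 [← hw1]
      rw [← Finset.sum_sub_distrib]
      refine Finset.sum_le_sum fun ω _ => ?_
      rw [← mul_one_sub]
      refine mul_le_mul_of_nonneg_left ?_ (hw0 ω)
      rw [RandPart.one_sub_sep]
      by_cases h : ‖signProj ω (f x - f y)‖ ^ 2 ≤ k * ‖f x - f y‖ ^ 2 / 4
      · rw [ind_true h, ← (D ω).w_sum]
        exact Finset.sum_le_sum fun i _ =>
          mul_le_of_le_one_right ((D ω).w_nonneg i) (ind_le_one _)
      · rw [ind_false h]
        refine (Finset.sum_eq_zero fun i _ => ?_).le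
        rw [ind_false, mul_zero]
        intro hr
        have h1 : ‖signProj ω (f x) - signProj ω (f y)‖ ≤ √k * Δ / 2 := hD1 ω i x y hr
        rw [← signProj_sub] at h1
        refine h ?_
        calc ‖signProj ω (f x - f y)‖ ^ 2 ≤ (√k * Δ / 2) ^ 2 := by gcongr
          _ = k * Δ ^ 2 / 4 := by
            rw [div_pow, mul_pow, Real.sq_sqrt (by linarith)]; norm_num
          _ ≤ k * ‖f x - f y‖ ^ 2 / 4 := by gcongr
    · intro h
      rw [h, norm_zero] at hxy
      linarith

/-- Euclidean point sets have `O(√(min (log n) d))`-Lipschitz decompositions. -/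
lemma finDecomp_euclidean {d : ℕ} (hd : 1 ≤ d) {α : Type} [Fintype α]
    (hα : 2 ≤ Fintype.card α) (f : α → EuclideanSpace ℝ (Fin d)) {Δ : ℝ} (hΔ : 0 < Δ) :
    FinDecomp (fun x y => ‖f x - f y‖) (180 * √(min (Real.log (Fintype.card α)) d)) Δ := by
  have hn : (2 : ℝ) ≤ (Fintype.card α : ℝ) := by exact_mod_cast hα
  set n : ℝ := (Fintype.card α : ℝ)
  have hnn : ∀ x y, 0 ≤ ‖f x - f y‖ := fun x y => norm_nonneg _
  rcases le_total (Real.log n) d with h | h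
  · rw [min_eq_left h]
    set L := Real.log n
    have hL : 0.69 ≤ L := by
      have := Real.log_le_log two_pos hn
      linarith [Real.log_two_gt_d9]
    set k := ⌈36 * L⌉₊ with hkdef
    have hk0 : 0 < k := Nat.ceil_pos.2 (by linarith)
    have hk1 : 36 * L ≤ k := Nat.le_ceil _
    have hk2 : (k : ℝ) ≤ 49 * L := by
      have := Nat.ceil_lt_add_one (show 0 ≤ 36 * L by linarith)
      linarith
    refine (finDecomp_of_signProj hk0 ?_ f hΔ).mono hnn hΔ ?_
    · change _ ≤ 1 / n ^ 3
      have : (1 : ℝ) / n ^ 3 = Real.exp (-(3 * L)) := by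
        rw [Real.exp_neg, one_div]
        congr 1
        rw [show 3 * L = ((3 : ℕ) : ℝ) * L by norm_num, Real.exp_nat_mul,
          Real.exp_log (by linarith)]
      rw [this]
      gcongr
      linarith
    · have h1 : √(k : ℝ) ≤ 7 * √L := by
        rw [Real.sqrt_le_left (by positivity), mul_pow, Real.sq_sqrt (by linarith)]
        linarith
      have h2 : 0.5 ≤ √L := Real.le_sqrt_of_sq_le (by norm_num; linarith)
      linarith
  · rw [min_eq_right h]
    have hd' : (1 : ℝ) ≤ d := by exact_mod_cast hd
    have hD := finDecomp_of_finrank (by simpa using hd) f hΔ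
    refine hD.mono hnn hΔ ?_
    have := Real.one_le_sqrt.2 hd'
    simp
    linarith

/-- The `ℓ_p` norm of a vector. -/
def finLpNorm {d : ℕ} (p : ℝ) (v : Fin d → ℝ) : ℝ := (∑ i, |v i| ^ p) ^ (1 / p)

/-- The Mazur map on the line. -/
def mazur (θ a : ℝ) : ℝ := a * |a| ^ (θ - 1)

lemma mazur_neg (θ a : ℝ) : mazur θ (-a) = -mazur θ a := by simp [mazur]

lemma mazur_of_nonneg {θ a : ℝ} (hθ : 1 ≤ θ) (ha : 0 ≤ a) : mazur θ a = a ^ θ := by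
  rw [mazur, abs_of_nonneg ha]
  nth_rewrite 1 [← Real.rpow_one a]
  rw [← Real.rpow_add_of_nonneg ha zero_le_one (by linarith)]
  congr 1
  ring

lemma forall_real_pair {Q : ℝ → ℝ → Prop} (hsymm : ∀ a b, Q a b → Q b a)
    (hneg : ∀ a b, Q a b → Q (-a) (-b)) (hsame : ∀ a b, 0 ≤ b → b ≤ a → Q a b)
    (hopp : ∀ a b, 0 ≤ a → 0 ≤ b → Q a (-b)) (a b : ℝ) : Q a b := by
  have hpos : ∀ a b, 0 ≤ a → 0 ≤ b → Q a b := fun a b ha hb =>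
    (le_total b a).elim (hsame a b hb) fun h => hsymm _ _ (hsame b a ha h)
  rcases le_total 0 a with ha | ha <;> rcases le_total 0 b with hb | hb
  · exact hpos a b ha hb
  · simpa using hopp a (-b) ha (by linarith)
  · simpa using hsymm _ _ (hopp b (-a) hb (by linarith))
  · simpa using hneg _ _ (hpos (-a) (-b) (by linarith) (by linarith))

lemma abs_mazur_sub_le {θ : ℝ} (h1 : 1 ≤ θ) (h2 : θ ≤ 2) (a b : ℝ) :
    |mazur θ a - mazur θ b| ≤ 2 * (|a| + |b|) ^ (θ - 1) * |a - b| := by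
  revert a b
  refine forall_real_pair ?_ ?_ ?_ ?_
  · intro a b h
    rwa [abs_sub_comm, abs_sub_comm b, add_comm]
  · intro a b h
    rwa [mazur_neg, mazur_neg, abs_neg, abs_neg, neg_sub_neg, neg_sub_neg, abs_sub_comm,
      abs_sub_comm b]
  · intro a b hb hab
    have ha := hb.trans hab
    rcases ha.eq_or_lt with rfl | ha'
    · obtain rfl : b = 0 := le_antisymm hab hb
      simp
    rw [mazur_of_nonneg h1 ha, mazur_of_nonneg h1 hb, abs_of_nonneg ha, abs_of_nonneg hb,
      abs_of_nonneg (sub_nonneg.2 hab),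
      abs_of_nonneg (sub_nonneg.2 (Real.rpow_le_rpow hb hab (by linarith)))]
    have hB := one_add_mul_self_le_rpow_one_add (s := b / a - 1)
      (by have := div_nonneg hb ha; linarith) h1
    rw [add_sub_cancel, Real.div_rpow hb ha, le_div_iff₀ (by positivity)] at hB
    have hA : a ^ θ = a ^ (θ - 1) * a := by
      rw [← Real.rpow_add_one ha'.ne', sub_add_cancel]
    have hE : (1 + θ * (b / a - 1)) * a ^ θ = a ^ θ - θ * (a ^ (θ - 1) * (a - b)) := by
      rw [hA]; field_simp; ring
    have hS : a ^ (θ - 1) ≤ (a + b) ^ (θ - 1) := by gcongr; linarith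
    have hab' := sub_nonneg.2 hab
    calc a ^ θ - b ^ θ ≤ θ * (a ^ (θ - 1) * (a - b)) := by linarith
      _ ≤ 2 * ((a + b) ^ (θ - 1) * (a - b)) := by gcongr
      _ = _ := by ring
  · intro a b ha hb
    rw [mazur_neg, sub_neg_eq_add, sub_neg_eq_add, abs_neg, mazur_of_nonneg h1 ha,
      mazur_of_nonneg h1 hb, abs_of_nonneg ha, abs_of_nonneg hb, abs_of_nonneg (by positivity),
      abs_of_nonneg (by positivity), mul_assoc]
    have h : (a + b) ^ (θ - 1) * (a + b) = (a + b) ^ θ := by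
      have := mazur_of_nonneg h1 (add_nonneg ha hb)
      rwa [mazur, abs_of_nonneg (by positivity), mul_comm] at this
    rw [h]
    have := Real.add_rpow_le_rpow_add ha hb h1
    have : 0 ≤ (a + b) ^ θ := by positivity
    linarith

lemma abs_mazur_two_sub_le (a b : ℝ) :
    |mazur 2 a - mazur 2 b| ≤ 1 * (|a| + |b|) ^ ((2 : ℝ) - 1) * |a - b| := by
  have h : ∀ t : ℝ, mazur 2 t = t * |t| := fun t => by
    rw [mazur, show (2 : ℝ) - 1 = 1 by norm_num, Real.rpow_one]
  rw [h, h, show (2 : ℝ) - 1 = 1 by norm_num, Real.rpow_one, one_mul]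
  rcases abs_cases a with ⟨ha, ha'⟩ | ⟨ha, ha'⟩ <;> rcases abs_cases b with ⟨hb, hb'⟩ | ⟨hb, hb'⟩ <;>
    rw [ha, hb] <;> rcases abs_cases (a - b) with ⟨hc, hc'⟩ | ⟨hc, hc'⟩ <;> rw [hc, abs_le] <;>
    constructor <;> nlinarith

lemma rpow_abs_sub_le_mazur {θ : ℝ} (h1 : 1 ≤ θ) (h2 : θ ≤ 2) (a b : ℝ) :
    |a - b| ^ θ ≤ 2 * |mazur θ a - mazur θ b| := by
  revert a b
  refine forall_real_pair ?_ ?_ ?_ ?_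
  · intro a b h
    rwa [abs_sub_comm, abs_sub_comm (mazur θ b)]
  · intro a b h
    rwa [mazur_neg, mazur_neg, neg_sub_neg, neg_sub_neg, abs_sub_comm, abs_sub_comm (mazur θ b)]
  · intro a b hb hab
    have ha := hb.trans hab
    rw [mazur_of_nonneg h1 ha, mazur_of_nonneg h1 hb, abs_of_nonneg (sub_nonneg.2 hab),
      abs_of_nonneg (sub_nonneg.2 (Real.rpow_le_rpow hb hab (by linarith)))]
    have := Real.add_rpow_le_rpow_add (sub_nonneg.2 hab) hb h1
    rw [sub_add_cancel] at this
    have : b ^ θ ≤ a ^ θ := Real.rpow_le_rpow hb hab (by linarith)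
    linarith
  · intro a b ha hb
    rw [mazur_neg, sub_neg_eq_add, sub_neg_eq_add, mazur_of_nonneg h1 ha,
      mazur_of_nonneg h1 hb, abs_of_nonneg (by positivity), abs_of_nonneg (by positivity)]
    lift a to ℝ≥0 using ha
    lift b to ℝ≥0 using hb
    have h : ((a : ℝ) + b) ^ θ ≤ 2 ^ (θ - 1) * ((a : ℝ) ^ θ + (b : ℝ) ^ θ) :=
      mod_cast NNReal.rpow_add_le_mul_rpow_add_rpow a b h1
    refine h.trans ?_
    gcongr
    calc (2 : ℝ) ^ (θ - 1) ≤ 2 ^ (1 : ℝ) :=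
          Real.rpow_le_rpow_of_exponent_le (by norm_num) (by linarith)
      _ = 2 := Real.rpow_one 2

section lpNorm
variable {d : ℕ} {p q θ : ℝ}

lemma finLpNorm_nonneg (p : ℝ) (v : Fin d → ℝ) : 0 ≤ finLpNorm p v := by
  unfold finLpNorm; positivity

lemma finLpNorm_abs_add_abs_le (hp : 1 ≤ p) (u v : Fin d → ℝ) :
    finLpNorm p (fun i => |u i| + |v i|) ≤ finLpNorm p u + finLpNorm p v := by
  simpa [finLpNorm] using Real.Lp_add_le Finset.univ (fun i => |u i|) (fun i => |v i|) hp

lemma finLpNorm_mazur_sub_le (hq : 1 ≤ q) (hθ : 1 < θ) {K : ℝ} (hK0 : 0 ≤ K)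
    (hK : ∀ a b, |mazur θ a - mazur θ b| ≤ K * (|a| + |b|) ^ (θ - 1) * |a - b|)
    (u v : Fin d → ℝ) :
    finLpNorm q (fun i => mazur θ (u i) - mazur θ (v i)) ≤
      K * finLpNorm (θ * q) (fun i => |u i| + |v i|) ^ (θ - 1) *
        finLpNorm (θ * q) (fun i => u i - v i) := by
  have hθ0 : 0 < θ := by linarith
  have hθ1 : 0 < θ - 1 := by linarith
  have hq0 : 0 < q := by linarith
  have hconj : (θ / (θ - 1)).HolderConjugate θ := (Real.HolderConjugate.conjExponent hθ).symm
  set A := ∑ i, |(|u i| + |v i|)| ^ (θ * q) with hA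
  set B := ∑ i, |u i - v i| ^ (θ * q) with hB
  have hA0 : 0 ≤ A := by positivity
  have hB0 : 0 ≤ B := by positivity
  have hH := Real.inner_le_Lp_mul_Lq_of_nonneg Finset.univ hconj
    (f := fun i => ((|u i| + |v i|) ^ (θ - 1)) ^ q) (g := fun i => |u i - v i| ^ q)
    (fun i _ => by positivity) (fun i _ => by positivity)
  have eA : ∑ i, (((|u i| + |v i|) ^ (θ - 1)) ^ q) ^ (θ / (θ - 1)) = A := by
    refine Finset.sum_congr rfl fun i _ => ?_
    have h : 0 ≤ |u i| + |v i| := by positivity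
    rw [abs_of_nonneg h, ← Real.rpow_mul h, ← Real.rpow_mul h]
    congr 1
    field_simp
  have eB : ∑ i, (|u i - v i| ^ q) ^ θ = B := by
    refine Finset.sum_congr rfl fun i _ => ?_
    rw [← Real.rpow_mul (by positivity), mul_comm]
  rw [eA, eB] at hH
  have hsum : ∑ i, |mazur θ (u i) - mazur θ (v i)| ^ q ≤
      K ^ q * (A ^ (1 / (θ / (θ - 1))) * B ^ (1 / θ)) := by
    calc _ ≤ ∑ i, K ^ q * (((|u i| + |v i|) ^ (θ - 1)) ^ q * |u i - v i| ^ q) := by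
          refine Finset.sum_le_sum fun i _ => ?_
          refine (Real.rpow_le_rpow (abs_nonneg _) (hK _ _) hq0.le).trans_eq ?_
          rw [Real.mul_rpow (by positivity) (by positivity),
            Real.mul_rpow hK0 (by positivity), mul_assoc]
      _ ≤ _ := by
          rw [← Finset.mul_sum]
          gcongr
  refine (Real.rpow_le_rpow (by positivity) hsum (by positivity : 0 ≤ 1 / q)).trans_eq ?_
  rw [Real.mul_rpow (by positivity) (by positivity), Real.mul_rpow (by positivity) (by positivity),
    ← Real.rpow_mul hK0, ← Real.rpow_mul hA0, ← Real.rpow_mul hB0, mul_one_div_cancel hq0.ne',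
    Real.rpow_one, finLpNorm, finLpNorm, ← hA, ← hB, ← Real.rpow_mul hA0, mul_assoc]
  congr 3
  · field_simp
  · field_simp

lemma rpow_finLpNorm_sub_le (hq : 1 ≤ q) (h1 : 1 ≤ θ) (h2 : θ ≤ 2) (u v : Fin d → ℝ) :
    finLpNorm (θ * q) (fun i => u i - v i) ^ θ ≤
      2 * finLpNorm q (fun i => mazur θ (u i) - mazur θ (v i)) := by
  have hθ0 : 0 < θ := by linarith
  have hq0 : 0 < q := by linarith
  have hB0 : 0 ≤ ∑ i, |u i - v i| ^ (θ * q) := by positivity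
  have hsum : ∑ i, |u i - v i| ^ (θ * q) ≤
      2 ^ q * ∑ i, |mazur θ (u i) - mazur θ (v i)| ^ q := by
    rw [Finset.mul_sum]
    refine Finset.sum_le_sum fun i _ => ?_
    rw [Real.rpow_mul (abs_nonneg _), ← Real.mul_rpow two_pos.le (abs_nonneg _)]
    exact Real.rpow_le_rpow (by positivity) (rpow_abs_sub_le_mazur h1 h2 _ _) hq0.le
  have := Real.rpow_le_rpow hB0 hsum (by positivity : 0 ≤ 1 / q)
  rw [Real.mul_rpow (by positivity) (by positivity), ← Real.rpow_mul two_pos.le,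
    mul_one_div_cancel hq0.ne', Real.rpow_one] at this
  rw [finLpNorm, ← Real.rpow_mul hB0]
  rw [show 1 / (θ * q) * θ = 1 / q by field_simp]
  exact this

end lpNorm

/-- All maps from `α` to `ℓ_p^d` pull back metrics with `β`-Lipschitz decompositions at every
scale. -/
def LpDecomposable (α : Type) (d : ℕ) (p β : ℝ) : Prop :=
  ∀ (f : α → Fin d → ℝ) (Δ : ℝ), 0 < Δ →
    FinDecomp (fun x y => finLpNorm p (fun i => f x i - f y i)) β Δ

lemma LpDecomposable.mono {α : Type} {d : ℕ} {p β β' : ℝ} (h : LpDecomposable α d p β)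
    (hβ : β ≤ β') : LpDecomposable α d p β' :=
  fun f Δ hΔ => (h f Δ hΔ).mono (fun _ _ => finLpNorm_nonneg _ _) hΔ hβ

lemma RandPart.sep_map_inf_le {α : Type} (P : RandPart α) (S : Setoid α) {x y : α} {c : ℝ}
    (hc : 0 ≤ c) (h : S.r x y → P.sep x y ≤ c) :
    (P.map fun R => S ⊓ R).sep x y ≤ ind (¬ S.r x y) + c := by
  by_cases hS : S.r x y
  · rw [ind_false (not_not.2 hS), zero_add]
    refine le_trans (le_of_eq ?_) (h hS)
    refine Finset.sum_congr rfl fun i _ => ?_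
    have : (S ⊓ P.R i).r x y ↔ (P.R i).r x y := and_iff_right hS
    exact congrArg (fun A : Prop => P.w i * ind (¬ A)) (propext this)
  · rw [ind_true hS]
    have := (P.map fun R => S ⊓ R).one_sub_sep x y
    have h0 : 0 ≤ 1 - (P.map fun R => S ⊓ R).sep x y := by
      rw [this]
      exact Finset.sum_nonneg fun i _ => mul_nonneg ((P.map _).w_nonneg i) (ind_nonneg _)
    linarith

/-- The refinement of a decomposition at scale `2 * Δ` through the Mazur map. -/
lemma FinDecomp.refine_mazur {α : Type} {d : ℕ} {q θ β K : ℝ} (hq : 1 ≤ q) (h1 : 1 < θ)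
    (h2 : θ ≤ 2) (hK0 : 0 ≤ K)
    (hK : ∀ a b, |mazur θ a - mazur θ b| ≤ K * (|a| + |b|) ^ (θ - 1) * |a - b|)
    (hβ : 0 ≤ β) (hdec : LpDecomposable α d q β) (f : α → Fin d → ℝ) {Δ : ℝ} (hΔ : 0 < Δ)
    (h : FinDecomp (fun x y => finLpNorm (θ * q) (fun i => f x i - f y i)) (16 * K * β) (2 * Δ)) :
    FinDecomp (fun x y => finLpNorm (θ * q) (fun i => f x i - f y i)) (16 * K * β) Δ := by
  obtain ⟨P, hP1, hP2⟩ := h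
  have hθ0 : 0 < θ := by linarith
  have hp : 1 ≤ θ * q := by nlinarith
  let rep : P.Ω → α → α := fun ω x => (Quotient.mk (P.R ω) x).out
  have hrep : ∀ ω x, (P.R ω).r x (rep ω x) := fun ω x =>
    (P.R ω).symm (Quotient.mk_out (s := P.R ω) x)
  have hrep' : ∀ ω x y, (P.R ω).r x y → rep ω x = rep ω y := fun ω x y hxy =>
    congrArg Quotient.out (Quotient.sound (s := P.R ω) hxy)
  have hQ := fun ω => hdec (fun x i => mazur θ (f x i - f (rep ω x) i)) (Δ ^ θ / 2)
    (by positivity)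
  choose Q hQ1 hQ2 using hQ
  refine ⟨RandPart.mix P.w P.w_nonneg P.w_sum
    fun ω => (Q ω).map fun R => P.R ω ⊓ R, ?_, ?_⟩
  · rintro ⟨ω, i⟩ x y ⟨hx, hy⟩
    have hl := rpow_finLpNorm_sub_le hq h1.le h2 (fun i => f x i - f (rep ω x) i)
      (fun i => f y i - f (rep ω x) i)
    have hu : finLpNorm q (fun i => mazur θ (f x i - f (rep ω x) i) -
      mazur θ (f y i - f (rep ω y) i)) ≤ Δ ^ θ / 2 := hQ1 ω i x y hy
    rw [← hrep' ω x y hx] at hu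
    simp only [sub_sub_sub_cancel_right] at hl
    exact (Real.rpow_le_rpow_iff (finLpNorm_nonneg _ _) hΔ.le hθ0).1 (by linarith)
  · intro x y
    set ρ := finLpNorm (θ * q) (fun i => f x i - f y i) with hρ
    have hρ0 : 0 ≤ ρ := finLpNorm_nonneg _ _
    have hsep : ∀ ω, ((Q ω).map fun R => P.R ω ⊓ R).sep x y ≤
        ind (¬ (P.R ω).r x y) + 8 * K * β * ρ / Δ := by
      intro ω
      refine RandPart.sep_map_inf_le _ _ (by positivity) fun hxy => (hQ2 ω x y).trans ?_
      have hu := finLpNorm_mazur_sub_le hq h1 hK0 hK (fun i => f x i - f (rep ω x) i)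
        (fun i => f y i - f (rep ω x) i)
      have hm := finLpNorm_abs_add_abs_le hp (fun i => f x i - f (rep ω x) i)
        (fun i => f y i - f (rep ω x) i)
      have hx1 := hP1 ω x _ (hrep ω x)
      have hy1 := hP1 ω y _ (hrep ω y)
      simp only [← hrep' ω x y hxy] at hx1 hy1 ⊢
      simp only [sub_sub_sub_cancel_right] at hu
      have h4 : (4 : ℝ) ^ (θ - 1) ≤ 4 := by
        calc (4 : ℝ) ^ (θ - 1) ≤ 4 ^ (1 : ℝ) :=
              Real.rpow_le_rpow_of_exponent_le (by norm_num) (by linarith)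
          _ = 4 := Real.rpow_one 4
      have hΔθ : Δ ^ θ = Δ ^ (θ - 1) * Δ := by
        rw [← Real.rpow_add_one hΔ.ne', sub_add_cancel]
      have hu' : finLpNorm q (fun i => mazur θ (f x i - f (rep ω x) i) -
          mazur θ (f y i - f (rep ω x) i)) ≤ K * (4 * Δ ^ (θ - 1)) * ρ := by
        refine hu.trans ?_
        gcongr
        calc _ ≤ (4 * Δ) ^ (θ - 1) :=
              Real.rpow_le_rpow (finLpNorm_nonneg _ _) (by linarith) (by linarith)
          _ = 4 ^ (θ - 1) * Δ ^ (θ - 1) := Real.mul_rpow (by norm_num) hΔ.le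
          _ ≤ _ := by gcongr
      calc _ ≤ β * (K * (4 * Δ ^ (θ - 1)) * ρ) / (Δ ^ θ / 2) := by gcongr
        _ = 8 * K * β * ρ / Δ := by
          rw [hΔθ]; field_simp; ring
    have hPs : P.sep x y ≤ 16 * K * β * ρ / (2 * Δ) := hP2 x y
    rw [RandPart.sep_mix]
    calc _ ≤ ∑ ω, P.w ω * (ind (¬ (P.R ω).r x y) + 8 * K * β * ρ / Δ) :=
          Finset.sum_le_sum fun ω _ => mul_le_mul_of_nonneg_left (hsep ω) (P.w_nonneg ω)
      _ = P.sep x y + 8 * K * β * ρ / Δ := by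
          simp only [mul_add, Finset.sum_add_distrib, ← Finset.sum_mul, P.w_sum, one_mul]
          rfl
      _ ≤ 16 * K * β * ρ / (2 * Δ) + 8 * K * β * ρ / Δ := by gcongr
      _ = 16 * K * β * ρ / Δ := by field_simp; ring

lemma LpDecomposable.mul_exponent {α : Type} [Fintype α] {d : ℕ} {q θ β K : ℝ} (hq : 1 ≤ q)
    (h1 : 1 < θ) (h2 : θ ≤ 2) (hK0 : 0 ≤ K)
    (hK : ∀ a b, |mazur θ a - mazur θ b| ≤ K * (|a| + |b|) ^ (θ - 1) * |a - b|)
    (hβ : 0 ≤ β) (hdec : LpDecomposable α d q β) :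
    LpDecomposable α d (θ * q) (16 * K * β) := by
  intro f Δ hΔ
  set ρ : α → α → ℝ := fun x y => finLpNorm (θ * q) (fun i => f x i - f y i) with hρ
  have hρ0 : ∀ x y, 0 ≤ ρ x y := fun x y => finLpNorm_nonneg _ _
  set D := ∑ x, ∑ y, ρ x y
  have hD : ∀ x y, ρ x y ≤ D := fun x y =>
    (Finset.single_le_sum (f := fun y => ρ x y) (fun y _ => hρ0 x y) (Finset.mem_univ y)).trans
      (Finset.single_le_sum (f := fun x => ∑ y, ρ x y)
        (fun x _ => Finset.sum_nonneg fun y _ => hρ0 x y) (Finset.mem_univ x))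
  have key : ∀ (j : ℕ) (Δ : ℝ), 0 < Δ → D ≤ 2 ^ j * Δ → FinDecomp ρ (16 * K * β) Δ := by
    intro j
    induction j with
    | zero =>
      intro Δ hΔ hj
      refine ⟨RandPart.pure ⊤, fun _ x y _ => (hD x y).trans (by simpa using hj), fun x y => ?_⟩
      rw [RandPart.sep_pure, ind_false (not_not.2 (by trivial))]
      have := hρ0 x y
      positivity
    | succ j ih =>
      intro Δ hΔ hj
      exact FinDecomp.refine_mazur hq h1 h2 hK0 hK hβ hdec f hΔ
        (ih (2 * Δ) (by positivity) (by rw [pow_succ] at hj; linarith))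
  obtain ⟨j, hj⟩ := pow_unbounded_of_one_lt (D / Δ) one_lt_two
  exact key j Δ hΔ ((div_lt_iff₀ hΔ).1 hj).le

lemma lpDecomposable_two {α : Type} [Fintype α] (hα : 2 ≤ Fintype.card α) {d : ℕ} (hd : 1 ≤ d) :
    LpDecomposable α d 2 (180 * √(min (Real.log (Fintype.card α)) d)) := by
  intro f Δ hΔ
  have := finDecomp_euclidean hd hα (fun x => WithLp.toLp 2 (f x)) hΔ
  convert this using 3 with x y
  rw [EuclideanSpace.norm_eq, finLpNorm, Real.sqrt_eq_rpow]
  simp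

lemma lpDecomposable {α : Type} [Fintype α] (hα : 2 ≤ Fintype.card α) {d : ℕ} (hd : 1 ≤ d)
    {p : ℝ} (hp : 2 ≤ p) :
    LpDecomposable α d p (360 * p ^ 4 * √(min (Real.log (Fintype.card α)) d)) := by
  set m := √(min (Real.log (Fintype.card α)) d)
  have hm : 0 ≤ m := Real.sqrt_nonneg _
  have hbase : ∀ q : ℝ, 2 ≤ q → q ≤ 4 → LpDecomposable α d q (5760 * m) := by
    intro q h2 h4
    rcases h2.eq_or_lt with rfl | h2
    · exact (lpDecomposable_two hα hd).mono (by linarith)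
    · have := (lpDecomposable_two hα hd).mul_exponent (θ := q / 2) (K := 2) (by norm_num)
        (by linarith) (by linarith) (by norm_num)
        (abs_mazur_sub_le (by linarith) (by linarith)) (by positivity)
      rw [div_mul_cancel₀ q two_ne_zero] at this
      exact this.mono (by linarith)
  have hpow : ∀ (q : ℝ), 2 ≤ q → q ≤ 4 → ∀ k : ℕ,
      LpDecomposable α d (2 ^ k * q) (16 ^ k * (5760 * m)) := by
    intro q h2 h4 k
    induction k with
    | zero => simpa using hbase q h2 h4
    | succ k ih =>
      have hk : (1 : ℝ) ≤ 2 ^ k := one_le_pow₀ one_le_two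
      have := ih.mul_exponent (θ := 2) (K := 1) (by nlinarith) one_lt_two le_rfl zero_le_one
        abs_mazur_two_sub_le (by positivity)
      convert this using 1 <;> ring
  obtain ⟨k, hk1, hk2⟩ := exists_nat_pow_near (x := p / 2) (y := (2 : ℝ)) (by linarith) one_lt_two
  have h0 : (0 : ℝ) < 2 ^ k := by positivity
  rw [pow_succ] at hk2
  have := hpow (p / 2 ^ k) (by rw [le_div_iff₀ h0]; linarith)
    (by rw [div_le_iff₀ h0]; linarith) k
  rw [mul_div_cancel₀ p h0.ne'] at this
  refine this.mono ?_
  have h16 : (16 : ℝ) ^ k ≤ p ^ 4 / 16 := by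
    calc (16 : ℝ) ^ k = (2 ^ k) ^ 4 := by rw [← pow_mul, mul_comm, pow_mul]; norm_num
      _ ≤ (p / 2) ^ 4 := by gcongr
      _ = p ^ 4 / 16 := by ring
  calc _ ≤ p ^ 4 / 16 * (5760 * m) := by gcongr
    _ = _ := by ring

/-- There is a universal constant `C > 0` such that for every real `p ≥ 2`, all integers
`d ≥ 1` and `n ≥ 2`, every `n`-point subset `M` of `ℓ_p^d`, and every `Δ > 0`, the metric
space `M` admits a `(C * p^4 * √(min (log n) d), Δ)`-Lipschitz decomposition. -/
theorem lipschitz_decomposition_lp_d :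
    ∃ C : ℝ, 0 < C ∧
      ∀ (p : ℝ), 2 ≤ p →
      ∀ [Fact (1 ≤ ENNReal.ofReal p)],
      ∀ (d n : ℕ), 1 ≤ d → 2 ≤ n →
      ∀ (M : Set (PiLp (ENNReal.ofReal p) (fun _ : Fin d => ℝ))),
        M.Finite → M.ncard = n →
        ∀ Δ : ℝ, 0 < Δ →
          LipschitzDecomp M (C * p ^ 4 * Real.sqrt (min (Real.log n) d)) Δ := by
  refine ⟨360, by norm_num, fun p hp _ d n hd hn M hM hMn Δ hΔ => ?_⟩
  have : Fintype M := hM.fintype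
  have hcard : Fintype.card M = n := by
    rw [← hMn, ← Nat.card_coe_set_eq, Nat.card_eq_fintype_card]
  have h := lpDecomposable (α := M) (by rw [hcard]; exact hn) hd hp (fun x i => x.1 i) Δ hΔ
  rw [hcard] at h
  refine FinDecomp.lipschitzDecomp ?_
  have hp' : (ENNReal.ofReal p).toReal = p := ENNReal.toReal_ofReal (by linarith)
  convert h using 3 with x y
  rw [Subtype.dist_eq, PiLp.dist_eq_sum (by rw [hp']; linarith), hp']
  rfl
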